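/- Let φ:(R,m,K)→(S,n,L) be a flat local homomorphism of Noetherian local rings with S/mS Gorenstein, and let z_1,…,z_d ∈ S be elements whose images form a system of parameters in S/mS. Let I ⊆ R be an ideal with ℓ(R/I) < ∞ and dim_K((I :_R m)/I) = 1, let u ∈ R be an element whose image generates the socle (I :_R m)/I of R/I, and let b ∈ S be an element whose image generates the socle of S/(mS + (z_1,…,z_d)S). Then the socle of S/(IS + (z_1,…,z_d)S) is one-dimensional over L and is generated by the image of ub. -/

import Mathlib

open IsLocalRing

/-- The Frobenius power `I^[q]` of an ideal: the ideal generated by the `q`-th powers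
of the elements of `I`. -/
def Ideal.frobPow {R : Type*} [CommRing R] (I : Ideal R) (q : ℕ) : Ideal R :=
  Ideal.span ((fun x : R => x ^ q) '' (I : Set R))

/-- `R°`: the complement in `R` of the union of the minimal primes of `R`. -/
def circComplement (R : Type*) [CommRing R] : Set R :=
  {c : R | ∀ P ∈ minimalPrimes R, c ∉ P}

/-- `x ∈ I*`: tight closure membership (`p` is the characteristic). -/
def MemTightClosure {R : Type*} [CommRing R] (p : ℕ) (I : Ideal R) (x : R) : Prop :=
  ∃ c ∈ circComplement R, ∃ N : ℕ, ∀ e : ℕ, N ≤ e → c * x ^ p ^ e ∈ I.frobPow (p ^ e)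

/-- An ideal is tightly closed if `I* = I`. -/
def Ideal.IsTightlyClosed {R : Type*} [CommRing R] (p : ℕ) (I : Ideal R) : Prop :=
  ∀ x : R, MemTightClosure p I x → x ∈ I

/-- An ideal is Frobenius closed if `x^q ∈ I^[q]` for some `q` implies `x ∈ I`. -/
def Ideal.IsFrobeniusClosed {R : Type*} [CommRing R] (p : ℕ) (I : Ideal R) : Prop :=
  ∀ x : R, (∃ e : ℕ, x ^ p ^ e ∈ I.frobPow (p ^ e)) → x ∈ I

/-- A ring is weakly F-regular if every ideal is tightly closed. -/
def IsWeaklyFRegular (R : Type*) [CommRing R] (p : ℕ) : Prop :=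
  ∀ I : Ideal R, I.IsTightlyClosed p

/-- A test element: an element of `R°` that works in every tight closure test. -/
def IsTestElement {R : Type*} [CommRing R] (p : ℕ) (c : R) : Prop :=
  c ∈ circComplement R ∧
    ∀ (I : Ideal R) (x : R), MemTightClosure p I x → ∀ e : ℕ, c * x ^ p ^ e ∈ I.frobPow (p ^ e)

/-- A (full) system of parameters of a local ring: `dim R` elements of the maximal
ideal generating an ideal whose radical is the maximal ideal. -/
def IsSystemOfParameters (R : Type*) [CommRing R] [IsLocalRing R] {n : ℕ} (x : Fin n → R) : Prop :=
  ringKrullDim R = n ∧ (∀ i, x i ∈ maximalIdeal R) ∧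
    maximalIdeal R ≤ (Ideal.span (Set.range x)).radical

/-- A parameter ideal: an ideal generated by part of a system of parameters. -/
def Ideal.IsParameterIdeal {R : Type*} [CommRing R] [IsLocalRing R] (I : Ideal R) : Prop :=
  ∃ (n k : ℕ) (h : k ≤ n) (x : Fin n → R), IsSystemOfParameters R x ∧
    I = Ideal.span (Set.range fun i : Fin k => x (Fin.castLE h i))

/-- A local ring is F-rational if every parameter ideal is tightly closed. -/
def IsFRational (R : Type*) [CommRing R] [IsLocalRing R] (p : ℕ) : Prop :=
  ∀ I : Ideal R, I.IsParameterIdeal → I.IsTightlyClosed p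

/-- A local ring is F-injective if every parameter ideal is Frobenius closed. -/
def IsFInjective (R : Type*) [CommRing R] [IsLocalRing R] (p : ℕ) : Prop :=
  ∀ I : Ideal R, I.IsParameterIdeal → I.IsFrobeniusClosed p

/-- A local ring is Cohen-Macaulay if some system of parameters is a regular sequence. -/
def IsCohenMacaulayLocalRing (R : Type*) [CommRing R] [IsLocalRing R] : Prop :=
  ∃ (n : ℕ) (x : Fin n → R), IsSystemOfParameters R x ∧
    RingTheory.Sequence.IsRegular R (List.ofFn x)

/-- An irreducible ideal: a proper ideal that is not the intersection of two
strictly larger ideals. -/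
def Ideal.IsIrreducible {R : Type*} [CommRing R] (I : Ideal R) : Prop :=
  I ≠ ⊤ ∧ ∀ A B : Ideal R, I = A ⊓ B → I = A ∨ I = B

/-- A local ring is Gorenstein if it is Cohen-Macaulay and some system of parameters
generates an irreducible ideal. -/
def IsGorensteinLocalRing (R : Type*) [CommRing R] [IsLocalRing R] : Prop :=
  ∃ (n : ℕ) (x : Fin n → R), IsSystemOfParameters R x ∧
    RingTheory.Sequence.IsRegular R (List.ofFn x) ∧
    (Ideal.span (Set.range x)).IsIrreducible

/-- The socle `(I :_R m)/I` of `R ⧸ I` is one-dimensional over the residue field,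
with (the image of) `u` as a generator. -/
def GeneratesSocle {R : Type*} [CommRing R] [IsLocalRing R] (I : Ideal R) (u : R) : Prop :=
  u ∈ Submodule.colon I (maximalIdeal R) ∧ u ∉ I ∧
    ∀ v ∈ Submodule.colon I (maximalIdeal R), ∃ r : R, v - r * u ∈ I

/-- `dim_K ((I :_R m)/I) = 1`: the socle of `R ⧸ I` is one-dimensional over the
residue field. -/
def SocleDimOne {R : Type*} [CommRing R] [IsLocalRing R] (I : Ideal R) : Prop :=
  ∃ u : R, GeneratesSocle I u

universe u

open RingTheory.Sequence CategoryTheory Abelian Pointwise in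
/-- Cutting down by a regular element lowers the depth by at most one. -/
theorem RingTheory.Sequence.IsRegular.exists_isRegular_quotSMulTop
    {A M : Type u} [CommRing A] [IsNoetherianRing A] [IsLocalRing A]
    [AddCommGroup M] [Module A M] [Module.Finite A M] {r : A} {rs : List A}
    (hreg : IsRegular M (r :: rs)) (hmem : ∀ a ∈ r :: rs, a ∈ maximalIdeal A)
    {y : A} (hy : IsSMulRegular M y) (hym : y ∈ maximalIdeal A) :
    ∃ rs' : List A, rs'.length = rs.length ∧ (∀ a ∈ rs', a ∈ maximalIdeal A) ∧
      IsRegular (QuotSMulTop y M) rs' := by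
  have : Nontrivial M := hreg.nontrivial
  have : Nontrivial (QuotSMulTop y M) := nontrivial_quotSMulTop_of_mem_maximalIdeal M hym
  have hlt (N : Type u) [AddCommGroup N] [Module A N] [Module.Finite A N] [Nontrivial N] :
      maximalIdeal A • (⊤ : Submodule A N) < ⊤ :=
    (Submodule.top_ne_ideal_smul_of_le_jacobson_annihilator
      (maximalIdeal_le_jacobson _)).symm.lt_top
  have hsupp : Module.support A (A ⧸ maximalIdeal A) =
      PrimeSpectrum.zeroLocus (maximalIdeal A) := by
    rw [Module.support_eq_zeroLocus, Ideal.annihilator_quotient]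
  have hext := ModuleCat.subsingleton_ext_of_exists_isRegular (maximalIdeal A)
    (ModuleCat.of A (A ⧸ maximalIdeal A)) hsupp.subset (ModuleCat.of A M) (hlt M)
    (r :: rs) hmem hreg
  refine ModuleCat.exists_isRegular_of_exists_subsingleton_ext (maximalIdeal A) rs.length
    (ModuleCat.of A (QuotSMulTop y M)) (hlt _)
    (ModuleCat.of A (A ⧸ maximalIdeal A)) hsupp fun i hi ↦ ?_
  rw [List.length_cons] at hext
  have zero1 := AddCommGrpCat.isZero_of_iff_subsingleton.mpr (hext i (by omega))
  have zero2 := AddCommGrpCat.isZero_of_iff_subsingleton.mpr (hext (i + 1) (by omega))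
  exact AddCommGrpCat.subsingleton_of_isZero <| ShortComplex.Exact.isZero_of_both_zeros
    ((Ext.covariant_sequence_exact₃' (ModuleCat.of A (A ⧸ maximalIdeal A))
      (IsSMulRegular.smulShortComplex_shortExact (M := ModuleCat.of A M) hy)) i (i + 1) rfl)
    (zero1.eq_zero_of_src _) (zero2.eq_zero_of_tgt _)

open Pointwise in
/-- An associated prime of `M` extends, together with an `M`-regular element, to an associated
prime of `M / xM`. -/
theorem exists_isAssociatedPrime_quotSMulTop
    {A M : Type*} [CommRing A] [IsNoetherianRing A] [IsLocalRing A]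
    [AddCommGroup M] [Module A M] [Module.Finite A M] {x : A}
    (hx : IsSMulRegular M x) (hxm : x ∈ maximalIdeal A) {P : Ideal A}
    (hP : IsAssociatedPrime P M) :
    ∃ Q : Ideal A, IsAssociatedPrime Q (QuotSMulTop x M) ∧ P ≤ Q ∧ x ∈ Q := by
  obtain ⟨hPp, w, hw⟩ := isAssociatedPrime_iff.mp hP
  let N : Submodule A M := Submodule.torsionBySet A M P
  have hwN : w ∈ N := (Submodule.mem_torsionBySet_iff _ _).mpr fun a ↦ by
    have := a.2
    simp only [hw] at this
    simpa [Submodule.mem_colon_singleton] using this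
  have hw0 : w ≠ 0 := by
    rintro rfl
    exact hPp.ne_top (by rw [hw]; ext; simp)
  obtain ⟨n, hnN, hn⟩ : ∃ n ∈ N, n ∉ x • (⊤ : Submodule A M) := by
    by_contra! hcon
    have hle : N ≤ Ideal.span {x} • N := by
      intro n hn
      obtain ⟨n', -, rfl⟩ := Submodule.mem_smul_pointwise_iff_exists _ _ _ |>.mp (hcon n hn)
      refine Submodule.smul_mem_smul (Ideal.mem_span_singleton_self x)
        ((Submodule.mem_torsionBySet_iff _ _).mpr fun p ↦ hx ?_)
      have := (Submodule.mem_torsionBySet_iff _ _).mp hn p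
      simp only [smul_zero]
      rw [smul_comm]
      exact this
    have hbot := Submodule.eq_bot_of_le_smul_of_le_jacobson_bot (Ideal.span {x}) N
      (IsNoetherian.noetherian _) hle
      ((Ideal.span_singleton_le_iff_mem _).mpr hxm |>.trans (maximalIdeal_le_jacobson _))
    exact hw0 (by simpa [hbot] using hwN)
  obtain ⟨Q, hQ, hle⟩ := exists_le_isAssociatedPrime_of_isNoetherianRing A
    ((x • (⊤ : Submodule A M)).mkQ n) (by simpa using hn)
  refine ⟨Q, hQ, fun p hp ↦ hle ?_, hle ?_⟩
  · rw [Submodule.mem_colon_singleton, ← map_smul,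
      show p • n = 0 from (Submodule.mem_torsionBySet_iff _ _).mp hnN ⟨p, hp⟩]
    simp
  · rw [Submodule.mem_colon_singleton, ← map_smul, Submodule.mem_bot, Submodule.mkQ_apply,
      Submodule.Quotient.mk_eq_zero]
    exact Submodule.smul_mem_pointwise_smul _ _ _ trivial

open RingTheory.Sequence in
/-- The depth of `M` is at most the dimension of `A ⧸ P` for every associated prime `P`. -/
theorem RingTheory.Sequence.IsRegular.length_le_ringKrullDim_of_isAssociatedPrime
    {A M : Type*} [CommRing A] [IsNoetherianRing A] [IsLocalRing A]
    [AddCommGroup M] [Module A M] [Module.Finite A M] {rs : List A}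
    (hreg : IsRegular M rs) (hmem : ∀ a ∈ rs, a ∈ maximalIdeal A)
    {P : Ideal A} (hP : IsAssociatedPrime P M) :
    (rs.length : WithBot ℕ∞) ≤ ringKrullDim (A ⧸ P) := by
  induction rs generalizing M P with
  | nil =>
    have : Nontrivial (A ⧸ P) := Ideal.Quotient.nontrivial_iff.mpr hP.isPrime.ne_top
    simpa using ringKrullDim_nonneg_of_nontrivial
  | cons x rs ih =>
    rw [isRegular_cons_iff] at hreg
    simp only [List.mem_cons, forall_eq_or_imp] at hmem
    obtain ⟨Q, hQ, hPQ, hxQ⟩ := exists_isAssociatedPrime_quotSMulTop hreg.1 hmem.1 hP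
    have := hP.isPrime
    have hxP : x ∉ P := fun h ↦ by
      have := biUnion_associatedPrimes_eq_compl_regular (R := A) (M := M)
      exact (this.subset (Set.mem_biUnion (show P ∈ associatedPrimes A M from hP) h)) hreg.1
    have hdim := ringKrullDim_succ_le_of_surjective (Ideal.Quotient.factor hPQ)
      (Ideal.Quotient.factor_surjective hPQ) (r := Ideal.Quotient.mk P x)
      (mem_nonZeroDivisors_of_ne_zero (by simpa [Ideal.Quotient.eq_zero_iff_mem] using hxP))
      (by simpa [Ideal.Quotient.eq_zero_iff_mem] using hxQ)
    refine le_trans ?_ hdim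
    push_cast [List.length_cons]
    gcongr
    exact ih hreg.2 hmem.2 hQ

/-- Elements generating an ideal primary to the maximal ideal bound the dimension. -/
theorem ringKrullDim_le_length_of_maximalIdeal_le_radical
    {A : Type*} [CommRing A] [IsNoetherianRing A] [IsLocalRing A] (ys : List A)
    (hmem : ∀ a ∈ ys, a ∈ maximalIdeal A)
    (hrad : maximalIdeal A ≤ (Ideal.ofList ys).radical) :
    ringKrullDim A ≤ ys.length := by
  classical
  have h0 : ringKrullDim (A ⧸ Ideal.span ((ys.toFinset : Finset A) : Set A)) ≤ 0 := by
    have hspan : Ideal.span ((ys.toFinset : Finset A) : Set A) = Ideal.ofList ys := by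
      simp [Ideal.ofList]
    rw [hspan]
    have : Ring.KrullDimLE 0 (A ⧸ Ideal.ofList ys) := by
      rw [Ring.krullDimLE_zero_iff]
      intro J hJ
      have : (J.comap (Ideal.Quotient.mk (Ideal.ofList ys))) = maximalIdeal A := by
        refine le_antisymm (le_maximalIdeal (Ideal.IsPrime.ne_top inferInstance)) (hrad.trans ?_)
        rw [Ideal.IsPrime.radical_le_iff inferInstance]
        intro a ha
        simp [Ideal.mem_comap, Ideal.Quotient.eq_zero_iff_mem.mpr ha]
      have hJ' := Ideal.map_comap_of_surjective _ Ideal.Quotient.mk_surjective J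
      have hmax : (J.comap (Ideal.Quotient.mk (Ideal.ofList ys))).IsMaximal :=
        this ▸ inferInstance
      rw [← hJ']
      refine (Ideal.map_eq_top_or_isMaximal_of_surjective _
        Ideal.Quotient.mk_surjective hmax).resolve_left ?_
      rw [hJ']
      exact hJ.ne_top
    exact Ring.krullDimLE_iff.mp this
  refine (ringKrullDim_le_ringKrullDim_quotient_add_card ys.toFinset ?_).trans ?_
  · rw [ringJacobson_eq_maximalIdeal]
    intro a ha
    exact hmem a (by simpa using ha)
  · calc _ ≤ (0 : WithBot ℕ∞) + ys.toFinset.card := by gcongr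
      _ ≤ _ := by
        rw [zero_add]
        exact_mod_cast ys.toFinset_card_le

open RingTheory.Sequence in
/-- In a module of depth `n`, any `n` elements that generate an ideal primary to the maximal ideal
modulo the annihilator form a weakly regular sequence. -/
theorem RingTheory.Sequence.IsRegular.isWeaklyRegular_of_maximalIdeal_le_radical
    {A M : Type u} [CommRing A] [IsNoetherianRing A] [IsLocalRing A]
    [AddCommGroup M] [Module A M] [Module.Finite A M] {rs ys : List A}
    (hreg : IsRegular M rs) (hmem : ∀ a ∈ rs, a ∈ maximalIdeal A)
    (hlen : ys.length = rs.length) (hymem : ∀ a ∈ ys, a ∈ maximalIdeal A)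
    (hrad : maximalIdeal A ≤ (Ideal.ofList ys ⊔ Module.annihilator A M).radical) :
    IsWeaklyRegular M ys := by
  induction ys generalizing M rs with
  | nil => simp
  | cons y ys ih =>
    obtain _ | ⟨r, rs⟩ := rs
    · simp at hlen
    simp only [List.mem_cons, forall_eq_or_imp] at hymem
    have hy : IsSMulRegular M y := by
      by_contra hcon
      have hcon' : y ∈ ({ r : A | IsSMulRegular M r }ᶜ : Set A) := hcon
      rw [← biUnion_associatedPrimes_eq_compl_regular] at hcon'
      obtain ⟨P, hP, hyP⟩ := Set.mem_iUnion₂.mp hcon'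
      have hdim := hreg.length_le_ringKrullDim_of_isAssociatedPrime hmem hP
      have hPp : P.IsPrime := IsAssociatedPrime.isPrime hP
      have : Nontrivial (A ⧸ P) := Ideal.Quotient.nontrivial_iff.mpr hPp.ne_top
      have : IsLocalRing (A ⧸ P) :=
        IsLocalRing.of_surjective' _ (Ideal.Quotient.mk_surjective (I := P))
      have hmap : (maximalIdeal A).map (Ideal.Quotient.mk P) = maximalIdeal (A ⧸ P) :=
        IsLocalRing.map_maximalIdeal_of_surjective _ Ideal.Quotient.mk_surjective
      have hle := ringKrullDim_le_length_of_maximalIdeal_le_radical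
        (ys.map (Ideal.Quotient.mk P)) (by
          simp only [List.mem_map, forall_exists_index, and_imp, forall_apply_eq_imp_iff₂]
          intro a ha
          rw [← hmap]
          exact Ideal.mem_map_of_mem _ (hymem.2 a ha)) (by
          rw [← hmap, ← Ideal.map_ofList]
          refine (Ideal.map_mono hrad).trans ((Ideal.map_radical_le _).trans
            (Ideal.radical_mono ?_))
          rw [Ideal.map_sup, Ideal.ofList_cons, Ideal.map_sup, sup_assoc]
          refine sup_le ?_ (sup_le le_rfl ?_)
          · rw [Ideal.map_le_iff_le_comap, Ideal.span_singleton_le_iff_mem, Ideal.mem_comap,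
              Ideal.Quotient.eq_zero_iff_mem.mpr hyP]
            exact zero_mem _
          · rw [Ideal.map_le_iff_le_comap]
            intro a ha
            rw [Ideal.mem_comap, Ideal.Quotient.eq_zero_iff_mem.mpr
              (IsAssociatedPrime.annihilator_le hP (by rwa [Submodule.annihilator_top]))]
            exact zero_mem _)
      have := hdim.trans hle
      simp only [List.length_cons, List.length_map] at this hlen
      norm_cast at this
      omega
    obtain ⟨rs', hlen', hmem', hreg'⟩ := hreg.exists_isRegular_quotSMulTop hmem hy hymem.1
    refine .cons hy (ih hreg' hmem' (by simp at hlen; omega) hymem.2 (hrad.trans ?_))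
    refine Ideal.radical_mono ?_
    rw [Ideal.ofList_cons]
    refine sup_le (sup_le ?_ le_sup_left) (le_sup_of_le_right ?_)
    · rw [Ideal.span_singleton_le_iff_mem]
      refine Ideal.mem_sup_right (Module.mem_annihilator.mpr fun q ↦ ?_)
      obtain ⟨q, rfl⟩ := Submodule.mkQ_surjective _ q
      rw [← map_smul, Submodule.mkQ_apply, Submodule.Quotient.mk_eq_zero]
      exact Submodule.smul_mem_pointwise_smul _ _ _ trivial
    · exact LinearMap.annihilator_le_of_surjective _ (Submodule.mkQ_surjective _)

/-- The equational criterion for flatness, modulo an ideal of the base ring. -/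
theorem Module.Flat.exists_of_sum_smul_mem_smul_top {A N ι : Type*} [CommRing A] [AddCommGroup N]
    [Module A N] [Module.Flat A N] [Fintype ι] {J : Ideal A} {a : ι → A} {x : ι → N}
    (h : ∑ i, a i • x i ∈ J • (⊤ : Submodule A N)) :
    ∃ (k : ℕ) (c : ι → Fin k → A) (y : Fin k → N),
      (∀ i, x i = ∑ j, c i j • y j) ∧ ∀ j, ∑ i, a i * c i j ∈ J := by
  have hspan : (⊤ : Submodule A N) = Submodule.span A (Set.range (id : N → N)) := by simp
  rw [hspan, Submodule.mem_ideal_smul_span_iff_exists_sum] at h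
  obtain ⟨b, hb, hsum⟩ := h
  obtain ⟨k, c, y, hy, hc⟩ := Module.Flat.isTrivialRelation_of_sum_smul_eq_zero (R := A)
    (f := Sum.elim a fun i : b.support ↦ -b i) (x := Sum.elim x fun i : b.support ↦ (i : N)) (by
      rw [Fintype.sum_sum_type]
      simp only [Sum.elim_inl, Sum.elim_inr, neg_smul, Finset.sum_neg_distrib]
      rw [← hsum, Finsupp.sum, Finset.sum_coe_sort b.support fun i ↦ b i • i]
      simp)
  refine ⟨k, fun i ↦ c (.inl i), y, fun i ↦ hy (.inl i), fun j ↦ ?_⟩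
  have := hc j
  rw [Fintype.sum_sum_type] at this
  simp only [Sum.elim_inl, Sum.elim_inr, neg_mul, Finset.sum_neg_distrib, add_neg_eq_zero] at this
  rw [this]
  exact sum_mem fun i _ ↦ J.mul_mem_right _ (hb i)

/-- In a flat module, `(J N : a) = (J : a) N`. -/
theorem Module.Flat.mem_colon_smul_top {A N : Type*} [CommRing A] [AddCommGroup N] [Module A N]
    [Module.Flat A N] {J : Ideal A} {a : A} {x : N} (h : a • x ∈ J • (⊤ : Submodule A N)) :
    x ∈ J.colon {a} • (⊤ : Submodule A N) := by
  obtain ⟨k, c, y, hy, hc⟩ := Module.Flat.exists_of_sum_smul_mem_smul_top (ι := Unit)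
    (a := fun _ ↦ a) (x := fun _ ↦ x) (J := J) (by simpa using h)
  rw [show x = _ from hy ()]
  refine sum_mem fun j _ ↦ Submodule.smul_mem_smul ?_ trivial
  rw [Submodule.mem_colon_singleton]
  simpa [mul_comm] using hc j

/-- Flatness of `R → S` is inherited by `R ⧸ I → S ⧸ IS`. -/
theorem Module.Flat.quotient_map {R S : Type*} [CommRing R] [CommRing S] [Algebra R S]
    [Module.Flat R S] (I : Ideal R) :
    Module.Flat (R ⧸ I) (S ⧸ I.map (algebraMap R S)) := by
  refine Module.Flat.iff_forall_isTrivialRelation.mpr fun {l a x} h ↦ ?_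
  choose a' ha using fun i ↦ Ideal.Quotient.mk_surjective (a i)
  choose x' hx using fun i ↦ Ideal.Quotient.mk_surjective (x i)
  obtain rfl : a = fun i ↦ Ideal.Quotient.mk I (a' i) := funext fun i ↦ (ha i).symm
  obtain rfl : x = fun i ↦ Ideal.Quotient.mk _ (x' i) := funext fun i ↦ (hx i).symm
  have hsmul (r : R) (s : S) : Ideal.Quotient.mk I r • Ideal.Quotient.mk
      (I.map (algebraMap R S)) s = Ideal.Quotient.mk _ (r • s) := by
    rw [Algebra.smul_def, Algebra.smul_def, map_mul]
    rfl
  simp only [hsmul, ← map_sum, Ideal.Quotient.eq_zero_iff_mem] at h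
  obtain ⟨k, c, y, hy, hc⟩ := Module.Flat.exists_of_sum_smul_mem_smul_top (A := R) (J := I)
    (a := a') (x := x') (by rwa [Ideal.smul_top_eq_map])
  refine ⟨k, fun i j ↦ Ideal.Quotient.mk I (c i j), fun j ↦ Ideal.Quotient.mk _ (y j),
    fun i ↦ ?_, fun j ↦ ?_⟩
  · simp only [hsmul, ← map_sum, ← hy]
  · simp only [← map_mul, ← map_sum, Ideal.Quotient.eq_zero_iff_mem, hc]

/-- Over an Artinian local ring, an endomorphism of a flat module that is injective on the closed
fiber is injective modulo every ideal. -/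
theorem Module.Flat.mem_smul_top_of_apply_mem_smul_top
    {A N : Type*} [CommRing A] [IsArtinianRing A] [IsLocalRing A]
    [AddCommGroup N] [Module A N] [Module.Flat A N] (f : N →ₗ[A] N)
    (hf : ∀ n, f n ∈ maximalIdeal A • (⊤ : Submodule A N) →
      n ∈ maximalIdeal A • (⊤ : Submodule A N))
    (J : Ideal A) {n : N} (h : f n ∈ J • (⊤ : Submodule A N)) : n ∈ J • (⊤ : Submodule A N) := by
  induction J using WellFoundedGT.induction generalizing n with
  | ind J ih =>
    by_cases hJ : J = ⊤
    · simp [hJ]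
    have : Nontrivial (A ⧸ J) := Ideal.Quotient.nontrivial_iff.mpr hJ
    obtain ⟨P, hP⟩ := associatedPrimes.nonempty A (A ⧸ J)
    obtain ⟨hPp, w, hw⟩ := isAssociatedPrime_iff.mp hP
    obtain ⟨a, rfl⟩ := Ideal.Quotient.mk_surjective w
    have hPm : P = maximalIdeal A := eq_maximalIdeal inferInstance
    have hcolon : J.colon {a} = maximalIdeal A := by
      rw [← hPm, hw]
      ext r
      rw [Submodule.mem_colon_singleton, Submodule.mem_colon_singleton, Submodule.mem_bot,
        ← Ideal.Quotient.eq_zero_iff_mem]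
      rfl
    have haJ : a ∉ J := fun h ↦ hPp.ne_top (by
      rw [hPm, ← hcolon, Ideal.eq_top_iff_one, Submodule.mem_colon_singleton]
      simpa)
    have hlt : J < J ⊔ Ideal.span {a} :=
      lt_of_le_of_ne le_sup_left fun h ↦ haJ (h ▸ Ideal.mem_sup_right
        (Ideal.mem_span_singleton_self a))
    have hn := ih _ hlt (Submodule.smul_mono_left le_sup_left h)
    rw [Submodule.sup_smul, Submodule.mem_sup] at hn
    obtain ⟨j, hj, t, ht, rfl⟩ := hn
    rw [Submodule.ideal_span_singleton_smul, Submodule.mem_smul_pointwise_iff_exists] at ht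
    obtain ⟨t, -, rfl⟩ := ht
    have hfj : f j ∈ J • (⊤ : Submodule A N) := by
      have := Submodule.mem_map_of_mem (f := f) hj
      rw [Submodule.map_smul''] at this
      exact Submodule.smul_mono le_rfl le_top this
    rw [map_add, Submodule.add_mem_iff_right _ hfj, map_smul] at h
    have := hf _ (hcolon ▸ Module.Flat.mem_colon_smul_top h)
    refine add_mem hj ?_
    refine Submodule.smul_induction_on (p := fun t ↦ a • t ∈ J • (⊤ : Submodule A N)) this ?_ ?_
    · intro r hr n hn
      rw [smul_smul, mul_comm]
      rw [← hcolon, Submodule.mem_colon_singleton] at hr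
      exact Submodule.smul_mem_smul hr hn
    · intro x y hx hy
      rw [smul_add]
      exact add_mem hx hy

/-- The cokernel of an endomorphism of a flat module that is injective modulo every ideal is
flat. -/
theorem Module.Flat.quotient_range
    {A N : Type*} [CommRing A] [AddCommGroup N] [Module A N] [Module.Flat A N] (f : N →ₗ[A] N)
    (hf : ∀ (J : Ideal A) n, f n ∈ J • (⊤ : Submodule A N) → n ∈ J • (⊤ : Submodule A N)) :
    Module.Flat A (N ⧸ LinearMap.range f) := by
  refine Module.Flat.iff_forall_isTrivialRelation.mpr fun {l a q} h ↦ ?_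
  choose n hn using fun i ↦ Submodule.mkQ_surjective _ (q i)
  obtain rfl : q = fun i ↦ Submodule.mkQ _ (n i) := funext fun i ↦ (hn i).symm
  simp only [← map_smul, ← map_sum] at h
  obtain ⟨w, hw⟩ := (Submodule.Quotient.mk_eq_zero _).mp h
  have hwJ := hf (Ideal.span (Set.range a)) w (by
    rw [hw]
    exact sum_mem fun i _ ↦ Submodule.smul_mem_smul (Ideal.subset_span ⟨i, rfl⟩) trivial)
  obtain ⟨m, rfl⟩ : ∃ m : Fin l → N, ∑ i, a i • m i = w := by
    refine Submodule.smul_induction_on hwJ ?_ ?_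
    · intro r hr n _
      obtain ⟨c, rfl⟩ := (Ideal.mem_span_range_iff_exists_fun).mp hr
      exact ⟨fun i ↦ c i • n, by simp only [Finset.sum_smul, smul_smul, mul_comm]⟩
    · rintro _ _ ⟨m, rfl⟩ ⟨m', rfl⟩
      exact ⟨m + m', by simp [Finset.sum_add_distrib]⟩
  obtain ⟨k, c, y, hy, hc⟩ := Module.Flat.isTrivialRelation_of_sum_smul_eq_zero (R := A)
    (f := a) (x := fun i ↦ n i - f (m i)) (by
      simp only [smul_sub, Finset.sum_sub_distrib, ← hw, map_sum, map_smul, sub_self])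
  refine ⟨k, c, fun j ↦ Submodule.mkQ _ (y j), fun i ↦ ?_, hc⟩
  have := congrArg (Submodule.mkQ (LinearMap.range f)) (hy i)
  rw [map_sub, map_sum, Submodule.mkQ_apply _ (f (m i)),
    (Submodule.Quotient.mk_eq_zero _).mpr (LinearMap.mem_range_self f (m i)), sub_zero] at this
  simpa only [map_smul] using this

open RingTheory.Sequence in
/-- A local criterion for flatness: over an Artinian local base, cutting a flat algebra down by
a sequence that is weakly regular on the closed fiber preserves flatness. -/
theorem RingTheory.Sequence.IsWeaklyRegular.flat_quotient_ofList
    {A B : Type*} [CommRing A] [IsArtinianRing A] [IsLocalRing A] [CommRing B] [Algebra A B]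
    [Module.Flat A B] {zs : List B}
    (hreg : IsWeaklyRegular (B ⧸ (maximalIdeal A).map (algebraMap A B)) zs) :
    Module.Flat A (B ⧸ Ideal.ofList zs) := by
  induction zs using List.reverseRecOn with
  | nil =>
    exact Module.Flat.of_linearEquiv
      ((Submodule.quotEquivOfEqBot (Ideal.ofList ([] : List B)) (by simp)).restrictScalars A)
  | append_singleton xs z ih =>
    rw [isWeaklyRegular_append_iff, isWeaklyRegular_singleton_iff,
      isSMulRegular_quotient_iff_mem_of_smul_mem] at hreg
    have := ih hreg.1
    have hfiber (b : B) : Ideal.Quotient.mk ((maximalIdeal A).map (algebraMap A B)) b ∈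
        (Ideal.ofList xs • ⊤ : Submodule B (B ⧸ (maximalIdeal A).map (algebraMap A B))) ↔
        Ideal.Quotient.mk (Ideal.ofList xs) b ∈
          maximalIdeal A • (⊤ : Submodule A (B ⧸ Ideal.ofList xs)) := by
      rw [Ideal.smul_top_eq_map (maximalIdeal A), Submodule.restrictScalars_mem,
        IsScalarTower.algebraMap_eq A B (B ⧸ Ideal.ofList xs), ← Ideal.map_map,
        Ideal.Quotient.algebraMap_eq, ← Ideal.mem_comap (f := Ideal.Quotient.mk (Ideal.ofList xs)),
        Ideal.comap_map_of_surjective _ Ideal.Quotient.mk_surjective,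
        ← RingHom.ker_eq_comap_bot, Ideal.mk_ker, sup_comm]
      have := Submodule.comap_smul_top_of_surjective (Ideal.ofList xs)
        ((maximalIdeal A).map (algebraMap A B)).mkQ (Submodule.mkQ_surjective _)
      rw [Submodule.ker_mkQ, smul_eq_mul, Ideal.mul_top] at this
      rw [← this]
      rfl
    let f : (B ⧸ Ideal.ofList xs) →ₗ[A] (B ⧸ Ideal.ofList xs) :=
      LinearMap.mulLeft A (Ideal.Quotient.mk _ z)
    have hflat : Module.Flat A ((B ⧸ Ideal.ofList xs) ⧸ LinearMap.range f) := by
      refine Module.Flat.quotient_range f fun J n ↦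
        Module.Flat.mem_smul_top_of_apply_mem_smul_top f (fun n hn ↦ ?_) J
      obtain ⟨b, rfl⟩ := Ideal.Quotient.mk_surjective n
      rw [LinearMap.mulLeft_apply, ← map_mul, ← hfiber] at hn
      exact (hfiber b).mp (hreg.2 _ hn)
    have hle : Ideal.ofList xs ≤ Ideal.ofList (xs ++ [z]) := by
      rw [Ideal.ofList_append]; exact le_sup_left
    let g : (B ⧸ Ideal.ofList xs) →ₗ[A] (B ⧸ Ideal.ofList (xs ++ [z])) :=
      (Ideal.Quotient.factorₐ A hle).toLinearMap
    have hker : LinearMap.range f = LinearMap.ker g := by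
      ext n
      obtain ⟨b, rfl⟩ := Ideal.Quotient.mk_surjective n
      change _ ↔ Ideal.Quotient.mk (Ideal.ofList (xs ++ [z])) b = 0
      rw [Ideal.Quotient.eq_zero_iff_mem, Ideal.ofList_append, Ideal.ofList_singleton,
        Submodule.mem_sup, LinearMap.mem_range]
      constructor
      · rintro ⟨c, hc⟩
        obtain ⟨c, rfl⟩ := Ideal.Quotient.mk_surjective c
        rw [LinearMap.mulLeft_apply, ← map_mul, Ideal.Quotient.eq] at hc
        exact ⟨b - z * c, by simpa using neg_mem hc, z * c,
          Ideal.mul_mem_right _ _ (Ideal.mem_span_singleton_self z), by ring⟩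
      · rintro ⟨y, hy, _, hc, rfl⟩
        obtain ⟨c, rfl⟩ := Ideal.mem_span_singleton'.mp hc
        refine ⟨Ideal.Quotient.mk _ c, ?_⟩
        rw [LinearMap.mulLeft_apply, ← map_mul, Ideal.Quotient.eq, ← neg_mem_iff]
        convert hy using 1
        ring
    have e := (Submodule.quotEquivOfEq _ _ hker).trans
      (g.quotKerEquivOfSurjective (Ideal.Quotient.factor_surjective hle))
    exact Module.Flat.of_linearEquiv e.symm

/-- If the elements of `A` annihilated by `K` are the multiples of `u`, the same holds in a flat
module. -/
theorem Module.Flat.exists_eq_smul_of_forall_smul_eq_zero {A N : Type*} [CommRing A]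
    [AddCommGroup N] [Module A N] [Module.Flat A N] {K : Ideal A} (hK : K.FG) {u : A}
    (hu : ∀ a, (∀ r ∈ K, r * a = 0) → u ∣ a) {t : N} (ht : ∀ r ∈ K, r • t = 0) :
    ∃ t', t = u • t' := by
  have : Module.Finite A K := Module.Finite.iff_fg.mpr hK
  obtain ⟨k, a, y, hya, haf⟩ := Module.Flat.exists_factorization_of_comp_eq_zero_of_free (R := A)
    (f := K.subtype) (x := LinearMap.toSpanSingleton A N t) (by
      ext r
      simpa using ht r r.2)
  have hdvd (j : Fin k) : u ∣ a 1 j := hu _ fun r hr ↦ by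
    have har : a r = 0 := LinearMap.congr_fun haf ⟨r, hr⟩
    rw [← mul_one r, ← smul_eq_mul, map_smul] at har
    simpa using DFunLike.congr_fun har j
  choose c hc using hdvd
  refine ⟨y (Finsupp.equivFunOnFinite.symm c), ?_⟩
  have h1 := LinearMap.congr_fun hya 1
  rw [LinearMap.toSpanSingleton_apply, one_smul, LinearMap.comp_apply] at h1
  rw [h1, ← map_smul]
  congr 1
  ext j
  simp [hc]

open RingTheory.Sequence in
/-- The closed fiber of `R ⧸ I → S ⧸ IS` is that of `R → S`. -/
theorem RingTheory.Sequence.IsWeaklyRegular.quotient_map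
    {R S : Type*} [CommRing R] [CommRing S] [Algebra R S] {I J : Ideal R} (hIJ : I ≤ J)
    {zs : List S} (h : IsWeaklyRegular (S ⧸ J.map (algebraMap R S)) zs) :
    IsWeaklyRegular ((S ⧸ I.map (algebraMap R S)) ⧸
      (J.map (Ideal.Quotient.mk I)).map (algebraMap (R ⧸ I) (S ⧸ I.map (algebraMap R S))))
      (zs.map (Ideal.Quotient.mk (I.map (algebraMap R S)))) := by
  have hmap : (J.map (Ideal.Quotient.mk I)).map
      (algebraMap (R ⧸ I) (S ⧸ I.map (algebraMap R S))) =
      (J.map (algebraMap R S)).map (Ideal.Quotient.mk (I.map (algebraMap R S))) := by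
    rw [Ideal.map_map, Ideal.map_map]
    rfl
  rw [hmap]
  refine (AddEquiv.isWeaklyRegular_congr
    (e := (DoubleQuot.quotQuotEquivQuotOfLE (Ideal.map_mono hIJ)).symm.toAddEquiv) ?_).mp h
  refine List.forall₂_map_right_iff.mpr (List.forall₂_same.mpr fun r _ x ↦ ?_)
  obtain ⟨x, rfl⟩ := Ideal.Quotient.mk_surjective x
  rfl

/-- (Part of the proof of Proposition 3.2 in Aberbach.) Let `φ : (R,m,K) → (S,n,L)` be a
flat local homomorphism of Noetherian local rings with `S/mS` Gorenstein, let
`z₁,…,z_d ∈ S` induce a system of parameters of `S/mS`, and let `I ⊆ R` have finite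
colength and one-dimensional socle generated by the image of `u`. If the image of `b`
generates the socle of `S/(mS + (z)S)`, then the socle of `S/(IS + (z)S)` is
one-dimensional over `L`, generated by the image of `u·b`. -/
theorem socle_of_extension_generated_by_mul
    (R S : Type*) [CommRing R] [CommRing S]
    [IsNoetherianRing R] [IsNoetherianRing S]
    [IsLocalRing R] [IsLocalRing S]
    [Algebra R S] [Module.Flat R S] [IsLocalHom (algebraMap R S)]
    [IsLocalRing (S ⧸ Ideal.map (algebraMap R S) (IsLocalRing.maximalIdeal R))]
    (hGor : IsGorensteinLocalRing (S ⧸ Ideal.map (algebraMap R S) (IsLocalRing.maximalIdeal R)))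
    (d : ℕ) (z : Fin d → S)
    (hz : IsSystemOfParameters (S ⧸ Ideal.map (algebraMap R S) (IsLocalRing.maximalIdeal R))
      (fun i => Ideal.Quotient.mk (Ideal.map (algebraMap R S) (IsLocalRing.maximalIdeal R)) (z i)))
    (I : Ideal R) (hlen : IsFiniteLength R (R ⧸ I))
    (u : R) (hu : GeneratesSocle I u)
    (b : S) (hb : GeneratesSocle
      (Ideal.map (algebraMap R S) (IsLocalRing.maximalIdeal R) ⊔ Ideal.span (Set.range z)) b) :
    GeneratesSocle (Ideal.map (algebraMap R S) I ⊔ Ideal.span (Set.range z))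
      (algebraMap R S u * b) := by
  set W := (maximalIdeal R).map (algebraMap R S)
  set Z := Ideal.span (Set.range z)
  have hofList {A : Type _} [CommRing A] {k : ℕ} (f : Fin k → A) :
      Ideal.ofList (List.ofFn f) = Ideal.span (Set.range f) := by
    simp [Ideal.ofList, List.mem_ofFn', Set.range]
  obtain ⟨n, x, hx, hreg, -⟩ := hGor
  obtain rfl : n = d := by exact_mod_cast hx.1.symm.trans hz.1
  have hwreg : RingTheory.Sequence.IsWeaklyRegular (S ⧸ W)
      (List.ofFn fun i ↦ Ideal.Quotient.mk W (z i)) := by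
    refine hreg.isWeaklyRegular_of_maximalIdeal_le_radical ?_ (by simp) ?_ ?_
    · simpa [List.mem_ofFn'] using hx.2.1
    · simpa [List.mem_ofFn'] using hz.2.1
    · rw [hofList]
      exact hz.2.2.trans (Ideal.radical_mono le_sup_left)
  have hwreg' : RingTheory.Sequence.IsWeaklyRegular (S ⧸ W) (List.ofFn z) := by
    rwa [← RingTheory.Sequence.isWeaklyRegular_map_algebraMap_iff (S ⧸ W), List.map_ofFn]
  have hI : I ≠ ⊤ := fun h ↦ hu.2.1 (h ▸ trivial)
  have hIm : I ≤ maximalIdeal R := le_maximalIdeal hI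
  have : Nontrivial (R ⧸ I) := Ideal.Quotient.nontrivial_iff.mpr hI
  have : IsLocalRing (R ⧸ I) := .of_surjective' _ Ideal.Quotient.mk_surjective
  have : IsArtinianRing (R ⧸ I) :=
    isArtinian_of_tower R (isFiniteLength_iff_isNoetherian_isArtinian.mp hlen).2
  have hmA := map_maximalIdeal_of_surjective (Ideal.Quotient.mk I) Ideal.Quotient.mk_surjective
  have hflat : Module.Flat (R ⧸ I) (S ⧸ I.map (algebraMap R S)) := Module.Flat.quotient_map I
  have hfib := hwreg'.quotient_map hIm
  rw [hmA] at hfib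
  have hT := hfib.flat_quotient_ofList
  rw [← Ideal.map_ofList, hofList] at hT
  let ρ : S →+* _ := (Ideal.Quotient.mk (Z.map (Ideal.Quotient.mk (I.map (algebraMap R S))))).comp
    (Ideal.Quotient.mk (I.map (algebraMap R S)))
  have hρ : Function.Surjective ρ :=
    Ideal.Quotient.mk_surjective.comp Ideal.Quotient.mk_surjective
  have hρ0 (s : S) : ρ s = 0 ↔ s ∈ I.map (algebraMap R S) ⊔ Z := by
    rw [RingHom.comp_apply, Ideal.Quotient.eq_zero_iff_mem, Ideal.mem_quotient_iff_mem_sup,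
      sup_comm]
  have hρsmul (r : R) (s : S) :
      Ideal.Quotient.mk I r • ρ s = ρ (algebraMap R S r * s) := by
    rw [Algebra.smul_def, map_mul]
    rfl
  have hcancel (s : S) (hs : algebraMap R S u * s ∈ I.map (algebraMap R S) ⊔ Z) : s ∈ W ⊔ Z := by
    rw [← hρ0, ← hρsmul] at hs
    have h := Module.Flat.mem_colon_smul_top (J := ⊥) (a := Ideal.Quotient.mk I u) (x := ρ s)
      (by rw [hs]; exact zero_mem _)
    have hcolon : (⊥ : Ideal (R ⧸ I)).colon {Ideal.Quotient.mk I u} ≤ maximalIdeal (R ⧸ I) :=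
      le_maximalIdeal fun htop ↦ hu.2.1 (by
        rw [Ideal.eq_top_iff_one, Submodule.mem_colon_singleton, one_smul] at htop
        exact Ideal.Quotient.eq_zero_iff_mem.mp htop)
    have h' := Submodule.smul_mono_left hcolon h
    rw [Ideal.smul_top_eq_map, Submodule.restrictScalars_mem, ← hmA, Ideal.map_map] at h'
    change ρ s ∈ ((maximalIdeal R).map (ρ.comp (algebraMap R S))) at h'
    rw [← Ideal.map_map, Ideal.mem_map_iff_of_surjective ρ hρ] at h'
    obtain ⟨w, hw, hws⟩ := h'
    rw [eq_comm, ← sub_eq_zero, ← map_sub, hρ0] at hws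
    rw [← sub_add_cancel s w]
    exact add_mem (sup_le_sup_right (Ideal.map_mono hIm) Z hws) (Ideal.mem_sup_left hw)
  have hdiv (v : S) (hv : ∀ r ∈ maximalIdeal R,
      algebraMap R S r * v ∈ I.map (algebraMap R S) ⊔ Z) :
      ∃ s, v - algebraMap R S u * s ∈ I.map (algebraMap R S) ⊔ Z := by
    have hdvd (a : R ⧸ I) (ha : ∀ r ∈ maximalIdeal (R ⧸ I), r * a = 0) :
        Ideal.Quotient.mk I u ∣ a := by
      obtain ⟨a, rfl⟩ := Ideal.Quotient.mk_surjective a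
      obtain ⟨r, hr⟩ := hu.2.2 a (Submodule.mem_colon.mpr fun y hy ↦ by
        have := ha _ (hmA ▸ Ideal.mem_map_of_mem _ hy)
        rwa [← map_mul, Ideal.Quotient.eq_zero_iff_mem, mul_comm] at this)
      exact ⟨Ideal.Quotient.mk I r, by rwa [← map_mul, mul_comm, Ideal.Quotient.eq]⟩
    have hann (r : R ⧸ I) (hr : r ∈ maximalIdeal (R ⧸ I)) : r • ρ v = 0 := by
      rw [← hmA, Ideal.mem_map_iff_of_surjective _ Ideal.Quotient.mk_surjective] at hr
      obtain ⟨r, hr, rfl⟩ := hr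
      rw [hρsmul, hρ0]
      exact hv r hr
    obtain ⟨t, ht⟩ := Module.Flat.exists_eq_smul_of_forall_smul_eq_zero
      (IsNoetherian.noetherian _) hdvd hann
    obtain ⟨s, rfl⟩ := hρ t
    rw [hρsmul, ← sub_eq_zero, ← map_sub, hρ0] at ht
    exact ⟨s, ht⟩
  have hmul {s : S} (hs : s ∈ W ⊔ Z) : algebraMap R S u * s ∈ I.map (algebraMap R S) ⊔ Z := by
    obtain ⟨w, hw, y, hy, rfl⟩ := Submodule.mem_sup.mp hs
    rw [mul_add]
    refine add_mem (Ideal.mem_sup_left ?_) (Ideal.mem_sup_right (Z.mul_mem_left _ hy))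
    have hle : Ideal.span {u} * maximalIdeal R ≤ I := by
      rw [Ideal.span_singleton_mul_le_iff]
      exact fun r hr ↦ Submodule.mem_colon.mp hu.1 r hr
    refine Ideal.map_mono hle ?_
    rw [Ideal.map_mul]
    exact Ideal.mul_mem_mul (Ideal.mem_map_of_mem _ (Ideal.mem_span_singleton_self u)) hw
  refine ⟨Submodule.mem_colon.mpr fun y hy ↦ ?_, fun h ↦ hb.2.1 (hcancel b h), fun v hv ↦ ?_⟩
  · rw [smul_eq_mul, mul_assoc]
    exact hmul (Submodule.mem_colon.mp hb.1 y hy)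
  · rw [Submodule.mem_colon] at hv
    obtain ⟨s, hs⟩ := hdiv v fun r hr ↦ by
      rw [mul_comm]
      exact hv _ (map_nonunit (algebraMap R S) r hr)
    obtain ⟨r, hr⟩ := hb.2.2 s (Submodule.mem_colon.mpr fun y hy ↦ hcancel _ (by
      have := sub_mem (hv y hy) (Ideal.mul_mem_right y _ hs)
      convert this using 1
      rw [smul_eq_mul, smul_eq_mul]
      ring))
    refine ⟨r, ?_⟩
    convert add_mem hs (hmul hr) using 1
    ring
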